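/- Let K be a positive real number and let (a_N)_{N≥1} be a sequence of positive real numbers with a_N → 0 as N → ∞. Then there exist a constant C > 0 and N₀ ∈ ℕ such that for all N ≥ N₀: for every X ∈ SO(2N+1) the quantity −Λ_X'(e^{-a_N/N})/Λ_X(e^{-a_N/N}) is positive, and |(a_N/N)^K ∫_{SO(2N+1)} (−Λ_X'(e^{-a_N/N})/Λ_X(e^{-a_N/N}))^K dHaar(X) − (1 − K a_N)| ≤ C ( a_N/N + a_N² ). -/

import Mathlib

open MeasureTheory Real Filter Matrix

noncomputable section

instance matrixMeasurableSpace {m n α : Type*} [MeasurableSpace α] :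
    MeasurableSpace (Matrix m n α) :=
  (inferInstance : MeasurableSpace (m → n → α))

/-- The special orthogonal group `SO(n)`, realised as the subgroup of the orthogonal group
`O(n)` consisting of matrices of determinant one. -/
def SOsub (n : ℕ) : Subgroup (Matrix.orthogonalGroup (Fin n) ℝ) where
  carrier := {X | (X : Matrix (Fin n) (Fin n) ℝ).det = 1}
  one_mem' := by simp
  mul_mem' := by
    intro a b ha hb
    simp only [Set.mem_setOf_eq] at *
    simp [Matrix.det_mul, ha, hb]
  inv_mem' := by
    intro a ha
    simp only [Set.mem_setOf_eq] at *
    have h : ((a⁻¹ * a : Matrix.orthogonalGroup (Fin n) ℝ) : Matrix (Fin n) (Fin n) ℝ) = 1 := by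
      simp
    have := congrArg Matrix.det h
    simp only [MulMemClass.coe_mul, Matrix.det_mul, ha, mul_one, Matrix.det_one] at this
    exact this

/-- The group `SO(2N+1)`. -/
abbrev SOodd (N : ℕ) := ↥(SOsub (2 * N + 1))

/-- The matrix underlying an element of `SO(2N+1)`. -/
def mat {N : ℕ} (X : SOodd N) : Matrix (Fin (2 * N + 1)) (Fin (2 * N + 1)) ℝ :=
  ((X : Matrix.orthogonalGroup (Fin (2 * N + 1)) ℝ) : Matrix (Fin (2 * N + 1)) (Fin (2 * N + 1)) ℝ)

/-- The characteristic polynomial `Λ_X(s) = det(I - s Xᵀ)` of `X ∈ SO(2N+1)`. -/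
def charPoly {N : ℕ} (X : SOodd N) (s : ℝ) : ℝ :=
  (1 - s • (mat X)ᵀ).det

namespace Matrix

variable {n : Type*} [Fintype n]

/-- The squared Frobenius norm of a real square matrix. -/
def frobSq (U : Matrix n n ℝ) : ℝ := (U * Uᵀ).trace

lemma frobSq_nonneg (U : Matrix n n ℝ) : 0 ≤ frobSq U := by
  simp only [frobSq, trace, diag_apply, mul_apply, transpose_apply]
  exact Finset.sum_nonneg fun i _ => Finset.sum_nonneg fun j _ => mul_self_nonneg _

lemma frobSq_sub_le (U V : Matrix n n ℝ) : frobSq (U - V) ≤ 2 * (frobSq U + frobSq V) := by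
  have h := frobSq_nonneg (U + V)
  have e : frobSq (U - V) + frobSq (U + V) = 2 * (frobSq U + frobSq V) := by
    simp only [frobSq, transpose_sub, transpose_add, sub_mul, mul_sub, add_mul, mul_add,
      trace_sub, trace_add]
    ring
  linarith

variable [DecidableEq n] {X : Matrix n n ℝ} {s : ℝ}

lemma frobSq_one_sub_smul_mul_ge (hX : Xᵀ * X = 1) (hs : 0 ≤ s) (U : Matrix n n ℝ) :
    (1 - s) ^ 2 * frobSq U ≤ frobSq ((1 - s • X) * U) := by
  have hXU : frobSq (X * U) = frobSq U := by
    rw [frobSq, frobSq, transpose_mul, trace_mul_comm, mul_assoc, ← mul_assoc Xᵀ, hX, one_mul,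
      trace_mul_comm]
  have h := frobSq_nonneg (X * U - U)
  have hc : (U * (X * U)ᵀ).trace = (X * U * Uᵀ).trace := by
    rw [← trace_transpose, transpose_mul, transpose_transpose]
  have e1 : frobSq (X * U - U) = 2 * frobSq U - 2 * (X * U * Uᵀ).trace := by
    have : frobSq (X * U - U)
        = frobSq (X * U) - (X * U * Uᵀ).trace - (U * (X * U)ᵀ).trace + frobSq U := by
      simp only [frobSq, transpose_sub, sub_mul, mul_sub, trace_sub]
      ring
    rw [this, hc, hXU]
    ring
  have e2 : frobSq ((1 - s • X) * U)
      = (1 + s ^ 2) * frobSq U - 2 * s * (X * U * Uᵀ).trace := by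
    have : frobSq ((1 - s • X) * U)
        = s ^ 2 * frobSq (X * U) - s * (X * U * Uᵀ).trace - s * (U * (X * U)ᵀ).trace
          + frobSq U := by
      simp only [frobSq, transpose_sub, sub_mul, mul_sub, trace_sub, one_mul, smul_mul_assoc,
        mul_smul_comm, transpose_smul, trace_smul, smul_eq_mul]
      ring
    rw [this, hc, hXU]
    ring
  rw [e2]
  nlinarith

lemma isUnit_det_one_sub_smul (hX : Xᵀ * X = 1) (hs : 0 ≤ s) (hs1 : s < 1) :
    IsUnit (1 - s • X).det := by
  rw [isUnit_iff_ne_zero]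
  intro h0
  obtain ⟨v, hv, hv0⟩ := exists_mulVec_eq_zero_iff.mpr h0
  have h := frobSq_one_sub_smul_mul_ge hX hs (vecMulVec v v)
  rw [mul_vecMulVec, hv0] at h
  have h1 : frobSq (vecMulVec v v) = (v ⬝ᵥ v) ^ 2 := by
    rw [frobSq, transpose_vecMulVec, vecMulVec_mul_vecMulVec, trace_vecMulVec]
    simp
    ring
  have h2 : 0 < v ⬝ᵥ v := by
    have := dotProduct_star_self_pos_iff.mpr hv
    simpa using this
  rw [h1] at h
  have h3 : 0 < (1 - s) ^ 2 * (v ⬝ᵥ v) ^ 2 := by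
    have : 0 < 1 - s := by linarith
    positivity
  simp [frobSq] at h
  linarith

/-- The resolvent `(1 - s X)⁻¹`. -/
def resolv (s : ℝ) (X : Matrix n n ℝ) : Matrix n n ℝ := (1 - s • X)⁻¹

lemma resolv_transpose : (resolv s X)ᵀ = resolv s Xᵀ := by
  simp [resolv, transpose_nonsing_inv]

lemma resolv_mul_cancel (hX : Xᵀ * X = 1) (hs : 0 ≤ s) (hs1 : s < 1) :
    resolv s X * (1 - s • X) = 1 :=
  nonsing_inv_mul _ (isUnit_det_one_sub_smul hX hs hs1)

lemma mul_resolv_cancel (hX : Xᵀ * X = 1) (hs : 0 ≤ s) (hs1 : s < 1) :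
    (1 - s • X) * resolv s X = 1 :=
  mul_nonsing_inv _ (isUnit_det_one_sub_smul hX hs hs1)

lemma frobSq_resolv_mul_le (hX : Xᵀ * X = 1) (hs : 0 ≤ s) (hs1 : s < 1) (U : Matrix n n ℝ) :
    (1 - s) ^ 2 * frobSq (resolv s X * U) ≤ frobSq U := by
  have h := frobSq_one_sub_smul_mul_ge hX hs (resolv s X * U)
  rwa [← mul_assoc, mul_resolv_cancel hX hs hs1, one_mul] at h

/-- For orthogonal `X`, the Poisson kernel identity for the resolvent. -/
lemma resolv_mul_transpose (hX : Xᵀ * X = 1) (hs : 0 ≤ s) (hs1 : s < 1) :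
    (1 - s ^ 2) • (resolv s X * (resolv s X)ᵀ) = resolv s X + (resolv s X)ᵀ - 1 := by
  have hX' : X * Xᵀ = 1 := mul_eq_one_comm.mp hX
  have h1 := resolv_mul_cancel hX hs hs1
  have h2 : (1 - s • Xᵀ) * (resolv s X)ᵀ = 1 := by
    rw [resolv_transpose]
    exact mul_resolv_cancel (by simpa using hX') hs hs1
  set R := resolv s X
  have key : (1 - s ^ 2) • (1 : Matrix n n ℝ)
      = (1 - s • X) + (1 - s • Xᵀ) - (1 - s • X) * (1 - s • Xᵀ) := by
    simp only [sub_mul, mul_sub, one_mul, mul_one, smul_mul_assoc, mul_smul_comm, hX']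
    module
  calc (1 - s ^ 2) • (R * Rᵀ) = R * ((1 - s ^ 2) • (1 : Matrix n n ℝ)) * Rᵀ := by simp
    _ = (R * (1 - s • X)) * Rᵀ + R * ((1 - s • Xᵀ) * Rᵀ)
        - (R * (1 - s • X)) * ((1 - s • Xᵀ) * Rᵀ) := by
      rw [key]; noncomm_ring
    _ = R + Rᵀ - 1 := by rw [h1, h2]; simp; abel

lemma commute_resolv_transpose (hX : Xᵀ * X = 1) (hs : 0 ≤ s) (hs1 : s < 1) :
    Commute (resolv s X) (resolv s X)ᵀ := by
  have h1 := resolv_mul_transpose hX hs hs1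
  have h2 := resolv_mul_transpose (X := Xᵀ) (by simpa using mul_eq_one_comm.mp hX) hs hs1
  rw [← resolv_transpose, transpose_transpose, add_comm (resolv s X)ᵀ, ← h1] at h2
  have h3 : (1 - s ^ 2) ≠ 0 := by nlinarith
  exact (smul_right_injective _ h3 h2).symm

/-- A rotation of an odd-dimensional space fixes a unit vector. -/
lemma exists_fixed_unit_vector (hX : Xᵀ * X = 1) (hdet : X.det = 1) (hn : Odd (Fintype.card n)) :
    ∃ v : n → ℝ, v ⬝ᵥ v = 1 ∧ X *ᵥ v = v := by
  have h0 : (1 - X).det = 0 := by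
    have h1 : (1 - X)ᵀ * X = -(1 - X) := by
      rw [transpose_sub, transpose_one, sub_mul, hX, one_mul]; abel
    have h2 := congrArg det h1
    rw [det_mul, det_transpose, hdet, mul_one, det_neg, hn.neg_one_pow] at h2
    linarith
  obtain ⟨v, hv, hv0⟩ := exists_mulVec_eq_zero_iff.mpr h0
  have hpos : 0 < v ⬝ᵥ v := by simpa using dotProduct_star_self_pos_iff.mpr hv
  have hfix : X *ᵥ v = v := by
    rw [sub_mulVec, one_mulVec, sub_eq_zero] at hv0
    exact hv0.symm
  refine ⟨(√(v ⬝ᵥ v))⁻¹ • v, ?_, by rw [mulVec_smul, hfix]⟩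
  rw [smul_dotProduct, dotProduct_smul, smul_eq_mul, smul_eq_mul, ← mul_assoc, ← mul_inv,
    Real.mul_self_sqrt hpos.le, inv_mul_cancel₀ hpos.ne']

lemma resolv_mulVec_of_fixed (hX : Xᵀ * X = 1) (hs : 0 ≤ s) (hs1 : s < 1) {v : n → ℝ}
    (hv : X *ᵥ v = v) : resolv s X *ᵥ v = (1 - s)⁻¹ • v := by
  have h1 : (1 - s • X) *ᵥ v = (1 - s) • v := by
    rw [sub_mulVec, one_mulVec, smul_mulVec, hv, sub_smul, one_smul]
  have h2 := congrArg (resolv s X *ᵥ ·) h1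
  simp only [mulVec_mulVec, resolv_mul_cancel hX hs hs1, one_mulVec, mulVec_smul] at h2
  have h3 : 1 - s ≠ 0 := by linarith
  rw [eq_inv_smul_iff₀ h3, ← h2]

/-- For `X ∈ SO(2N+1)` with eigenvalues `1, e^{± i θ_j}`, this is
`∑ j, (1 - s²) / |1 - s e^{i θ_j}|²`,
the total Poisson mass of the nontrivial eigenvalues. -/
def poissonSum (N : ℕ) (s : ℝ) (X : Matrix n n ℝ) : ℝ := (resolv s X).trace - N - (1 - s)⁻¹

lemma frobSq_resolv (hX : Xᵀ * X = 1) (hs : 0 ≤ s) (hs1 : s < 1) :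
    (1 - s ^ 2) * frobSq (resolv s X) = 2 * (resolv s X).trace - Fintype.card n := by
  have h := congrArg trace (resolv_mul_transpose hX hs hs1)
  simp only [trace_smul, trace_sub, trace_add, trace_transpose, trace_one, smul_eq_mul] at h
  rw [frobSq, h]
  ring

lemma poissonSum_eq_frobSq {N : ℕ} (hN : Fintype.card n = 2 * N + 1) (hX : Xᵀ * X = 1)
    (hs : 0 ≤ s) (hs1 : s < 1) {v : n → ℝ} (hv1 : v ⬝ᵥ v = 1) (hv : X *ᵥ v = v) :
    2 * poissonSum N s X = (1 - s ^ 2) * frobSq (resolv s X * (1 - vecMulVec v v)) := by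
  have hR := resolv_mulVec_of_fixed hX hs hs1 hv
  have hT := frobSq_resolv hX hs hs1
  have h1 : resolv s X * (1 - vecMulVec v v) = resolv s X - vecMulVec ((1 - s)⁻¹ • v) v := by
    rw [mul_sub, mul_one, mul_vecMulVec, hR]
  have hcross : (resolv s X * (vecMulVec ((1 - s)⁻¹ • v) v)ᵀ).trace = ((1 - s)⁻¹) ^ 2 := by
    rw [transpose_vecMulVec, mul_vecMulVec, hR, trace_vecMulVec, smul_dotProduct, dotProduct_smul,
      hv1]
    simp [pow_two]
  have hcross' : (vecMulVec ((1 - s)⁻¹ • v) v * (resolv s X)ᵀ).trace = ((1 - s)⁻¹) ^ 2 := by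
    rw [← hcross, ← trace_transpose, transpose_mul, transpose_transpose]
  have hsq : (vecMulVec ((1 - s)⁻¹ • v) v * (vecMulVec ((1 - s)⁻¹ • v) v)ᵀ).trace
      = ((1 - s)⁻¹) ^ 2 := by
    rw [transpose_vecMulVec, vecMulVec_mul_vecMulVec, hv1, one_smul, trace_vecMulVec,
      smul_dotProduct, dotProduct_smul, hv1]
    simp [pow_two]
  have h2 : frobSq (resolv s X * (1 - vecMulVec v v))
      = frobSq (resolv s X) - ((1 - s)⁻¹) ^ 2 := by
    rw [h1, frobSq, transpose_sub, sub_mul, mul_sub, mul_sub, trace_sub, trace_sub, trace_sub,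
      hcross, hcross', hsq, frobSq]
    ring
  rw [h2, mul_sub, hT, hN, poissonSum]
  have h3 : 1 - s ≠ 0 := by linarith
  push_cast
  field_simp
  ring

lemma poissonSum_nonneg {N : ℕ} (hN : Fintype.card n = 2 * N + 1) (hX : Xᵀ * X = 1)
    (hdet : X.det = 1) (hs : 0 ≤ s) (hs1 : s < 1) : 0 ≤ poissonSum N s X := by
  obtain ⟨v, hv1, hv⟩ := exists_fixed_unit_vector hX hdet ⟨N, hN⟩
  have h := poissonSum_eq_frobSq hN hX hs hs1 hv1 hv
  have h1 : 0 ≤ (1 - s ^ 2) * frobSq (resolv s X * (1 - vecMulVec v v)) :=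
    mul_nonneg (by nlinarith) (frobSq_nonneg _)
  linarith

/-- The term of the loop equation coming from the derivative of the test function. -/
def loopCorrection (s : ℝ) (X : Matrix n n ℝ) : ℝ :=
  (resolv s X * ((resolv s X - 1) * resolv s X)ᵀ).trace
    - (resolv s X * ((resolv s X - 1) * resolv s X)).trace

lemma loopCorrection_eq_frobSq (hX : Xᵀ * X = 1) (hs : 0 ≤ s) (hs1 : s < 1) :
    2 * loopCorrection s X
      = (1 - s ^ 2) * frobSq ((resolv s X - (resolv s X)ᵀ) * resolv s X) := by
  have hP := resolv_mul_transpose hX hs hs1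
  have hc : (resolv s X)ᵀ * resolv s X = resolv s X * (resolv s X)ᵀ :=
    (commute_resolv_transpose hX hs hs1).eq.symm
  rw [loopCorrection, frobSq]
  set R := resolv s X
  have h1 : (1 - s ^ 2) * ((R - Rᵀ) * R * ((R - Rᵀ) * R)ᵀ).trace
      = ((R - Rᵀ) * (R + Rᵀ - 1) * (Rᵀ - R)).trace := by
    rw [← hP, ← smul_eq_mul, ← trace_smul]
    simp only [transpose_mul, transpose_sub, transpose_transpose, smul_mul_assoc, mul_smul_comm,
      mul_assoc]
  rw [h1]
  have t1 : (R * (R * R)).trace = (Rᵀ * (Rᵀ * Rᵀ)).trace := by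
    rw [← trace_transpose]; simp [transpose_mul, mul_assoc]
  have t2 : (R * R).trace = (Rᵀ * Rᵀ).trace := by
    rw [← trace_transpose]; simp [transpose_mul]
  have t3 : (R * (Rᵀ * Rᵀ)).trace = (R * (R * Rᵀ)).trace := by
    rw [← trace_transpose]; simp [transpose_mul, mul_assoc]
  have t4 : (Rᵀ * (R * Rᵀ)).trace = (R * (Rᵀ * Rᵀ)).trace := by
    rw [← mul_assoc, hc, mul_assoc]
  have t5 : (R - Rᵀ) * (R + Rᵀ - 1) * (Rᵀ - R)
      = R * (R * Rᵀ) - R * Rᵀ - Rᵀ * (Rᵀ * Rᵀ) + Rᵀ * Rᵀ - R * (R * R) + R * R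
        + Rᵀ * (Rᵀ * R) - Rᵀ * R := by
    have : (R - Rᵀ) * (R + Rᵀ - 1) = R * R - R - Rᵀ * Rᵀ + Rᵀ := by
      simp only [sub_mul, mul_sub, mul_add, mul_one, hc]
      abel
    rw [this]
    noncomm_ring
  rw [t5]
  simp only [transpose_mul, transpose_sub, mul_sub, sub_mul, one_mul, trace_sub, trace_add, hc, t4,
    ← t3, ← t1, ← t2]
  ring

lemma loopCorrection_le {N : ℕ} (hN : Fintype.card n = 2 * N + 1) (hX : Xᵀ * X = 1)
    (hdet : X.det = 1) (hs : 0 ≤ s) (hs1 : s < 1) :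
    loopCorrection s X ≤ 4 * ((1 - s)⁻¹) ^ 2 * poissonSum N s X := by
  obtain ⟨v, hv1, hv⟩ := exists_fixed_unit_vector hX hdet ⟨N, hN⟩
  have hX' : Xᵀᵀ * Xᵀ = 1 := by simpa using mul_eq_one_comm.mp hX
  have hv' : Xᵀ *ᵥ v = v := by
    conv_lhs => rw [← hv, mulVec_mulVec, hX, one_mulVec]
  have hP := poissonSum_eq_frobSq hN hX hs hs1 hv1 hv
  have hT := loopCorrection_eq_frobSq hX hs hs1
  have hR := resolv_mulVec_of_fixed hX hs hs1 hv
  have hR' := resolv_mulVec_of_fixed hX' hs hs1 hv'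
  rw [← resolv_transpose] at hR'
  have hJ : (resolv s X - (resolv s X)ᵀ) * resolv s X
      = (resolv s X - (resolv s X)ᵀ) * (resolv s X * (1 - vecMulVec v v)) := by
    have : (resolv s X - (resolv s X)ᵀ) * (resolv s X * vecMulVec v v) = 0 := by
      rw [mul_vecMulVec, mul_vecMulVec, hR, mulVec_smul, sub_mulVec, hR, hR', sub_self, smul_zero]
      simp
    rw [mul_sub, mul_one, mul_sub, this, sub_zero]
  rw [hJ, sub_mul (resolv s X)] at hT
  set U := resolv s X * (1 - vecMulVec v v)
  have b1 := frobSq_resolv_mul_le hX hs hs1 U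
  have b2 := frobSq_resolv_mul_le hX' hs hs1 U
  rw [← resolv_transpose] at b2
  have b3 := frobSq_sub_le (resolv s X * U) ((resolv s X)ᵀ * U)
  have h3 : 0 < 1 - s := by linarith
  have h4 : 0 ≤ 1 - s ^ 2 := by nlinarith
  rw [inv_pow, ← div_eq_mul_inv, div_mul_eq_mul_div, le_div_iff₀ (by positivity)]
  have b4 : (1 - s) ^ 2 * frobSq (resolv s X * U - (resolv s X)ᵀ * U) ≤ 4 * frobSq U := by
    nlinarith [mul_le_mul_of_nonneg_left b3 (sq_nonneg (1 - s))]
  nlinarith [mul_le_mul_of_nonneg_left b4 h4]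

/-- The loop equation integrand in terms of `poissonSum`. -/
lemma trace_resolv_loop {N : ℕ} (hN : Fintype.card n = 2 * N + 1) (hX : Xᵀ * X = 1)
    (hs : 0 ≤ s) (hs1 : s < 1) :
    (resolv s X * (resolv s X - 1)ᵀ).trace - (resolv s X).trace * (resolv s X - 1).trace
      = N ^ 2 - poissonSum N s X ^ 2 - 2 * s / (1 - s ^ 2) * poissonSum N s X := by
  have hT := frobSq_resolv hX hs hs1
  have h3 : 1 - s ≠ 0 := by linarith
  have h4 : 1 - s ^ 2 ≠ 0 := by nlinarith
  have hT' : frobSq (resolv s X) = (2 * (resolv s X).trace - Fintype.card n) / (1 - s ^ 2) := by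
    rw [eq_div_iff h4, ← hT]; ring
  have h1 : (resolv s X * (resolv s X - 1)ᵀ).trace
      = frobSq (resolv s X) - (resolv s X).trace := by
    rw [frobSq, transpose_sub, transpose_one, mul_sub, mul_one, trace_sub]
  rw [h1, hT', trace_sub, trace_one, hN, poissonSum]
  have h5 : 1 - s ^ 2 = (1 - s) * (1 + s) := by ring
  have h6 : 1 + s ≠ 0 := by linarith
  rw [h5]
  push_cast
  field_simp
  ring

section Calculus

open NormedSpace
open scoped Norms.Operator

lemma hasDerivAt_trace_mul_resolv_exp (hX : Xᵀ * X = 1) (hs : 0 ≤ s) (hs1 : s < 1)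
    (A C : Matrix n n ℝ) :
    HasDerivAt (fun t : ℝ => (C * resolv s (exp (t • A) * X)).trace)
      (C * (resolv s X * (s • (A * X)) * resolv s X)).trace 0 := by
  have h1 : HasDerivAt (fun t : ℝ => exp (t • A)) A 0 := by
    have h := hasDerivAt_exp_smul_const A (0 : ℝ)
    rw [zero_smul, NormedSpace.exp_zero, one_mul] at h
    exact h
  have h2 : HasDerivAt (fun t : ℝ => 1 - s • (exp (t • A) * X)) (-(s • (A * X))) 0 :=
    ((h1.mul_const X).const_smul s).const_sub 1
  have hu : IsUnit (1 - s • X) :=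
    (isUnit_iff_isUnit_det _).mpr (isUnit_det_one_sub_smul hX hs hs1)
  have hval : 1 - s • (exp ((0 : ℝ) • A) * X) = hu.unit := by simp
  have h3 := hasFDerivAt_ringInverse (𝕜 := ℝ) hu.unit
  rw [← hval] at h3
  have h4 := h3.comp_hasDerivAt (0 : ℝ) h2
  have hinv : ((hu.unit⁻¹ : (Matrix n n ℝ)ˣ) : Matrix n n ℝ) = resolv s X := by
    rw [coe_units_inv]; rfl
  let L : Matrix n n ℝ →ₗ[ℝ] ℝ := traceLinearMap n ℝ ℝ ∘ₗ LinearMap.mulLeft ℝ C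
  have h5 := (LinearMap.toContinuousLinearMap L).hasFDerivAt.comp_hasDerivAt (0 : ℝ) h4
  have h6 : (fun t : ℝ => (C * resolv s (exp (t • A) * X)).trace)
      = LinearMap.toContinuousLinearMap L ∘ Ring.inverse ∘
        fun t : ℝ => 1 - s • (exp (t • A) * X) := by
    funext t
    simp [L, resolv, nonsing_inv_eq_ringInverse]
  rw [h6]
  refine h5.congr_deriv ?_
  change (C * _).trace = _
  simp [hinv]

end Calculus

lemma hasDerivAt_det_one_sub_smul (hX : Xᵀ * X = 1) (hs : 0 ≤ s) (hs1 : s < 1) :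
    HasDerivAt (fun r : ℝ => (1 - r • X).det)
      (-((1 - s • X).det * (X * resolv s X).trace)) s := by
  have h : ∀ r : ℝ, (1 - r • X).det
      = (1 - s • X).det * (1 + (r - s) • -(X * resolv s X)).det := by
    intro r
    have : 1 - r • X = (1 + (r - s) • -(X * resolv s X)) * (1 - s • X) := by
      rw [add_mul, smul_mul_assoc, neg_mul, mul_assoc, resolv_mul_cancel hX hs hs1]
      simp only [one_mul, mul_one]
      module
    rw [this, det_mul, mul_comm]
  rw [funext fun r => (h r).trans (congrArg _ (det_one_add_smul _ _))]
  set p := (det (1 + (Polynomial.X : Polynomial ℝ) • (-(X * resolv s X)).map Polynomial.C)).divX.divX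
  have h1 : HasDerivAt (fun r : ℝ => r - s) 1 s := (hasDerivAt_id s).sub_const s
  have h2 := ((((h1.const_mul (trace (-(X * resolv s X)))).const_add 1).add
    ((HasDerivAt.comp (h := fun r => r - s) s (p.hasDerivAt (s - s)) h1).mul (h1.pow 2))).const_mul
      (1 - s • X).det)
  refine h2.congr_deriv ?_
  simp

lemma smul_mul_resolv (hX : Xᵀ * X = 1) (hs : 0 ≤ s) (hs1 : s < 1) :
    s • (X * resolv s X) = resolv s X - 1 := by
  have h := mul_resolv_cancel hX hs hs1
  rw [sub_mul, one_mul, smul_mul_assoc] at h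
  rw [← h]; abel

/-- The infinitesimal rotation in the `(i, j)` coordinate plane. -/
def planeGen (i j : n) : Matrix n n ℝ := single i j 1 - single j i 1

lemma planeGen_transpose {ι : Type*} [DecidableEq ι] (i j : ι) :
    (planeGen i j)ᵀ = -planeGen i j := by
  simp [planeGen]

lemma trace_planeGen_mul (i j : n) (M : Matrix n n ℝ) :
    (planeGen i j * M).trace = M j i - M i j := by
  simp [planeGen, sub_mul, trace_single_mul]

lemma mul_single_mul_apply (M Q : Matrix n n ℝ) (i j k l : n) :
    (M * (single i j (1 : ℝ) * Q) : Matrix n n ℝ) k l = M k i * Q j l := by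
  rw [mul_apply, Finset.sum_eq_single i]
  · simp
  · intro b _ hb
    simp [hb]
  · simp

lemma sum_trace_planeGen_mul_mul (M Q : Matrix n n ℝ) :
    ∑ i, ∑ j, (planeGen i j * M * planeGen i j * Q).trace
      = 2 * ((M * Qᵀ).trace - M.trace * Q.trace) := by
  have h : ∀ i j, (planeGen i j * M * planeGen i j * Q).trace
      = M j i * Q j i + M i j * Q i j - M j j * Q i i - M i i * Q j j := by
    intro i j
    rw [mul_assoc, mul_assoc, trace_planeGen_mul, planeGen, sub_mul, mul_sub, sub_apply, sub_apply,
      mul_single_mul_apply, mul_single_mul_apply, mul_single_mul_apply, mul_single_mul_apply]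
    ring
  simp_rw [h]
  simp only [Finset.sum_sub_distrib, Finset.sum_add_distrib, trace, diag_apply, mul_apply,
    transpose_apply, ← Finset.mul_sum, ← Finset.sum_mul]
  rw [Finset.sum_comm]
  ring

lemma sum_trace_planeGen_mul_trace (M Q : Matrix n n ℝ) :
    ∑ i, ∑ j, (planeGen i j * M).trace * (planeGen i j * Q).trace
      = 2 * ((M * Qᵀ).trace - (M * Q).trace) := by
  simp_rw [trace_planeGen_mul]
  simp only [trace, diag_apply, mul_apply, transpose_apply, sub_mul, mul_sub,
    Finset.sum_sub_distrib]
  rw [Finset.sum_comm (f := fun i j => M j i * Q j i), Finset.sum_comm (f := fun i j => M j i * Q i j)]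
  ring

end Matrix

section Haar

/-- The mean over a compact group of a derivative along a one-parameter subgroup vanishes. -/
lemma integral_deriv_oneParam_eq_zero {G : Type*} [Group G] [TopologicalSpace G] [ContinuousMul G]
    [CompactSpace G] [MeasurableSpace G] [BorelSpace G] (ν : Measure G) [IsFiniteMeasure ν]
    [ν.IsMulLeftInvariant] {g : ℝ → G} (hg : ∀ t u, g (t + u) = g t * g u) {F F' : G → ℝ}
    (hF : Continuous F) (hF' : Continuous F')
    (hd : ∀ X, HasDerivAt (fun t => F (g t * X)) (F' X) 0) : ∫ X, F' X ∂ν = 0 := by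
  obtain ⟨B, hB⟩ := (isCompact_range hF'.norm).bddAbove
  have hfi : ∀ f : G → ℝ, Continuous f → Integrable f ν := fun f hf =>
    hf.integrable_of_hasCompactSupport (HasCompactSupport.of_compactSpace f)
  have hdt : ∀ X t, HasDerivAt (fun t => F (g t * X)) (F' (g t * X)) t := by
    intro X t
    have h := hd (g t * X)
    rw [← sub_self t] at h
    have h2 := HasDerivAt.comp (h := fun u => u - t) t h ((hasDerivAt_id t).sub_const t)
    rw [mul_one] at h2
    refine h2.congr_of_eventuallyEq (Filter.Eventually.of_forall fun u => ?_)
    simp only [Function.comp, ← mul_assoc, ← hg, sub_add_cancel]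
  have key := (hasDerivAt_integral_of_dominated_loc_of_deriv_le (μ := ν) (x₀ := (0 : ℝ))
    (F := fun t X => F (g t * X)) (F' := fun t X => F' (g t * X)) (bound := fun _ => B)
    Filter.univ_mem
    (Filter.Eventually.of_forall fun t =>
      (hF.comp (continuous_const_mul (g t))).aestronglyMeasurable)
    (hfi _ (hF.comp (continuous_const_mul (g 0))))
    (hF'.comp (continuous_const_mul (g 0))).aestronglyMeasurable
    (Filter.Eventually.of_forall fun X t _ => hB ⟨g t * X, rfl⟩) (integrable_const B)
    (Filter.Eventually.of_forall fun X t _ => hdt X t)).2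
  simp only [integral_mul_left_eq_self] at key
  exact key.unique (hasDerivAt_const _ _)

instance matrixBorelSpace {m n : Type*} [Countable m] [Countable n] :
    BorelSpace (Matrix m n ℝ) :=
  inferInstanceAs (BorelSpace (m → n → ℝ))

variable {N : ℕ}

lemma mat_transpose_mul (X : SOodd N) : (mat X)ᵀ * mat X = 1 :=
  (mem_orthogonalGroup_iff' _ _).mp X.1.2

lemma mat_det (X : SOodd N) : (mat X).det = 1 := X.2

lemma mat_mul (X Y : SOodd N) : mat (X * Y) = mat X * mat Y := rfl

lemma continuous_mat : Continuous (mat : SOodd N → _) :=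
  continuous_subtype_val.comp continuous_subtype_val

/-- An orthogonal matrix of determinant one, as an element of `SO(2N+1)`. -/
def ofMat (M : Matrix (Fin (2 * N + 1)) (Fin (2 * N + 1)) ℝ) (hM : Mᵀ * M = 1)
    (hdet : M.det = 1) : SOodd N :=
  ⟨⟨M, (mem_orthogonalGroup_iff' _ _).mpr hM⟩, hdet⟩

instance : CompactSpace (SOodd N) := by
  have hind : Topology.IsInducing (mat : SOodd N → _) :=
    Topology.IsInducing.subtypeVal.comp Topology.IsInducing.subtypeVal
  rw [← isCompact_univ_iff, hind.isCompact_iff]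
  have hrange : Set.image mat (Set.univ : Set (SOodd N))
      = {M : Matrix (Fin (2 * N + 1)) (Fin (2 * N + 1)) ℝ | Mᵀ * M = 1 ∧ M.det = 1} := by
    ext M
    constructor
    · rintro ⟨X, -, rfl⟩
      exact ⟨mat_transpose_mul X, mat_det X⟩
    · rintro ⟨h1, h2⟩
      exact ⟨ofMat M h1 h2, trivial, rfl⟩
  rw [hrange]
  have hK : IsCompact (Set.univ.pi fun _ : Fin (2 * N + 1) =>
      Set.univ.pi fun _ : Fin (2 * N + 1) => Set.Icc (-1 : ℝ) 1) :=
    isCompact_univ_pi fun _ => isCompact_univ_pi fun _ => isCompact_Icc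
  refine IsCompact.of_isClosed_subset hK ?_ ?_
  · exact (isClosed_eq (by fun_prop) continuous_const).inter
      (isClosed_eq (continuous_id.matrix_det) continuous_const)
  · rintro M ⟨h1, -⟩ i - j -
    have h := congrFun (congrFun h1 j) j
    rw [mul_apply, one_apply_eq] at h
    have h2 : M i j * M i j ≤ 1 := by
      rw [← h]
      exact Finset.single_le_sum (f := fun k => Mᵀ j k * M k j)
        (fun k _ => mul_self_nonneg (M k j)) (Finset.mem_univ i)
    exact abs_le.mp (abs_le_one_iff_mul_self_le_one.mpr h2)

lemma continuous_resolv_mat {s : ℝ} (hs : 0 ≤ s) (hs1 : s < 1) :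
    Continuous fun X : SOodd N => resolv s (mat X) := by
  have h : Continuous fun X : SOodd N => 1 - s • mat X :=
    continuous_const.sub (continuous_mat.const_smul s)
  simp only [resolv, inv_def, Ring.inverse_eq_inv']
  exact (h.matrix_det.inv₀ fun X =>
    (isUnit_det_one_sub_smul (mat_transpose_mul X) hs hs1).ne_zero).smul h.matrix_adjugate

lemma continuous_poissonSum_mat {s : ℝ} (hs : 0 ≤ s) (hs1 : s < 1) :
    Continuous fun X : SOodd N => poissonSum N s (mat X) :=
  ((continuous_resolv_mat hs hs1).matrix_trace.sub continuous_const).sub continuous_const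

lemma exp_skew_transpose_mul {n : Type*} [Fintype n] [DecidableEq n] {A : Matrix n n ℝ}
    (hA : Aᵀ = -A) : (NormedSpace.exp A)ᵀ * NormedSpace.exp A = 1 := by
  rw [← exp_transpose, hA, ← Matrix.exp_add_of_commute _ _ (Commute.neg_left (Commute.refl A)),
    neg_add_cancel, NormedSpace.exp_zero]

lemma det_exp_skew {n : Type*} [Fintype n] [DecidableEq n] {A : Matrix n n ℝ}
    (hA : Aᵀ = -A) : (NormedSpace.exp A).det = 1 := by
  have h1 : A = (1 / 2 : ℝ) • A + (1 / 2 : ℝ) • A := by module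
  have hA' : ((1 / 2 : ℝ) • A)ᵀ = -((1 / 2 : ℝ) • A) := by
    rw [transpose_smul, hA, smul_neg]
  have h2 := congrArg det (exp_skew_transpose_mul hA')
  rw [det_mul, det_transpose, det_one] at h2
  rw [h1, Matrix.exp_add_of_commute _ _ (Commute.refl _), det_mul, h2]

/-- The one-parameter group of rotations in the `(i, j)` coordinate plane. -/
def planeRot (i j : Fin (2 * N + 1)) (t : ℝ) : SOodd N :=
  have h : (t • planeGen i j)ᵀ = -(t • planeGen i j) := by
    rw [transpose_smul, planeGen_transpose, smul_neg]
  ofMat (NormedSpace.exp (t • planeGen i j)) (exp_skew_transpose_mul h) (det_exp_skew h)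

lemma mat_planeRot (i j : Fin (2 * N + 1)) (t : ℝ) :
    mat (planeRot i j t) = NormedSpace.exp (t • planeGen i j) := rfl

lemma planeRot_add (i j : Fin (2 * N + 1)) (t u : ℝ) :
    planeRot i j (t + u) = planeRot i j t * planeRot i j u := by
  apply Subtype.ext
  apply Subtype.ext
  change mat (planeRot i j (t + u)) = mat (planeRot i j t * planeRot i j u)
  rw [mat_mul, mat_planeRot, mat_planeRot, mat_planeRot, add_smul,
    Matrix.exp_add_of_commute _ _ (((Commute.refl _).smul_left t).smul_right u)]

/-- The loop (Schwinger–Dyson) equation with test function `poissonSum ^ m`. -/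
lemma integral_loop_equation (ν : Measure (SOodd N)) [IsFiniteMeasure ν] [ν.IsMulLeftInvariant]
    {s : ℝ} (hs : 0 ≤ s) (hs1 : s < 1) (m : ℕ) :
    ∫ X, ((N ^ 2 - poissonSum N s (mat X) ^ 2 - 2 * s / (1 - s ^ 2) * poissonSum N s (mat X))
        * poissonSum N s (mat X) ^ m
      + loopCorrection s (mat X) * (m * poissonSum N s (mat X) ^ (m - 1))) ∂ν = 0 := by
  have hRc := continuous_resolv_mat (N := N) hs hs1
  have hPc := continuous_poissonSum_mat (N := N) hs hs1
  let R' (i j : Fin (2 * N + 1)) (X : SOodd N) :=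
    resolv s (mat X) * (s • (planeGen i j * mat X)) * resolv s (mat X)
  let D (i j : Fin (2 * N + 1)) (X : SOodd N) : ℝ :=
    (planeGen i j * R' i j X).trace * poissonSum N s (mat X) ^ m
      + (planeGen i j * resolv s (mat X)).trace
        * (m * poissonSum N s (mat X) ^ (m - 1) * (R' i j X).trace)
  have hDc : ∀ i j, Continuous (D i j) := by
    intro i j
    have hR'c : Continuous (R' i j) :=
      (hRc.mul ((continuous_const.mul continuous_mat).const_smul s)).mul hRc
    exact ((continuous_const.mul hR'c).matrix_trace.mul (hPc.pow m)).add
      ((continuous_const.mul hRc).matrix_trace.mul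
        ((continuous_const.mul (hPc.pow (m - 1))).mul hR'c.matrix_trace))
  have hD : ∀ i j, ∫ X, D i j X ∂ν = 0 := by
    intro i j
    refine integral_deriv_oneParam_eq_zero ν (planeRot_add i j)
      (F := fun X => (planeGen i j * resolv s (mat X)).trace * poissonSum N s (mat X) ^ m)
      ((continuous_const.mul hRc).matrix_trace.mul (hPc.pow m)) (hDc i j) fun X => ?_
    have hX := mat_transpose_mul X
    have h1 := hasDerivAt_trace_mul_resolv_exp hX hs hs1 (planeGen i j) (planeGen i j)
    have h2 := hasDerivAt_trace_mul_resolv_exp hX hs hs1 (planeGen i j) 1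
    simp only [one_mul] at h2
    have h3 := h1.mul (((h2.sub_const (N : ℝ)).sub_const (1 - s)⁻¹).pow m)
    refine h3.congr_deriv ?_
    simp [D, R', poissonSum]
  have hsum : ∀ X, ∑ i, ∑ j, D i j X
      = 2 * ((N ^ 2 - poissonSum N s (mat X) ^ 2
          - 2 * s / (1 - s ^ 2) * poissonSum N s (mat X)) * poissonSum N s (mat X) ^ m
        + loopCorrection s (mat X) * (m * poissonSum N s (mat X) ^ (m - 1))) := by
    intro X
    have hX := mat_transpose_mul X
    have hR' : ∀ i j, R' i j X = resolv s (mat X) * planeGen i j * (resolv s (mat X) - 1) := by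
      intro i j
      rw [← smul_mul_resolv hX hs hs1]
      simp only [R', mul_assoc, smul_mul_assoc, mul_smul_comm]
    have h1 : ∀ i j, D i j X
        = (planeGen i j * resolv s (mat X) * planeGen i j * (resolv s (mat X) - 1)).trace
            * poissonSum N s (mat X) ^ m
          + (planeGen i j * resolv s (mat X)).trace
              * (planeGen i j * ((resolv s (mat X) - 1) * resolv s (mat X))).trace
            * (m * poissonSum N s (mat X) ^ (m - 1)) := by
      intro i j
      have h2 : (R' i j X).trace
          = (planeGen i j * ((resolv s (mat X) - 1) * resolv s (mat X))).trace := by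
        rw [hR', mul_assoc, trace_mul_comm, mul_assoc]
      simp only [D]
      rw [h2, hR', ← mul_assoc, ← mul_assoc]
      ring
    simp_rw [h1, Finset.sum_add_distrib, ← Finset.sum_mul, sum_trace_planeGen_mul_mul,
      sum_trace_planeGen_mul_trace]
    rw [trace_resolv_loop (N := N) (by simp) hX hs hs1, loopCorrection]
    ring
  have hfi : ∀ i j, Integrable (D i j) ν := fun i j =>
    (hDc i j).integrable_of_hasCompactSupport (HasCompactSupport.of_compactSpace _)
  have htot : ∫ X, ∑ i, ∑ j, D i j X ∂ν = 0 := by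
    rw [integral_finsetSum _ fun i _ => integrable_finsetSum _ fun j _ => hfi i j]
    refine Finset.sum_eq_zero fun i _ => ?_
    rw [integral_finsetSum _ fun j _ => hfi i j]
    exact Finset.sum_eq_zero fun j _ => hD i j
  simp_rw [hsum, integral_const_mul] at htot
  linarith

end Haar

section Moments

variable {N : ℕ}

lemma integral_poissonSum_pow_succ_le (ν : Measure (SOodd N)) [IsFiniteMeasure ν]
    [ν.IsMulLeftInvariant] {s : ℝ} (hs : 0 ≤ s) (hs1 : s < 1) (m : ℕ) :
    2 * s / (1 - s ^ 2) * ∫ X, poissonSum N s (mat X) ^ (m + 1) ∂ν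
      ≤ (N ^ 2 + 4 * m * ((1 - s)⁻¹) ^ 2) * ∫ X, poissonSum N s (mat X) ^ m ∂ν := by
  have hPc := continuous_poissonSum_mat (N := N) hs hs1
  have hRc := continuous_resolv_mat (N := N) hs hs1
  have hTc : Continuous fun X : SOodd N => loopCorrection s (mat X) := by
    have h : Continuous fun X : SOodd N => (resolv s (mat X) - 1) * resolv s (mat X) :=
      (hRc.sub continuous_const).mul hRc
    exact (hRc.mul h.matrix_transpose).matrix_trace.sub (hRc.mul h).matrix_trace
  have hfi : ∀ f : SOodd N → ℝ, Continuous f → Integrable f ν := fun f hf =>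
    hf.integrable_of_hasCompactSupport (HasCompactSupport.of_compactSpace f)
  have hP0 : ∀ X : SOodd N, 0 ≤ poissonSum N s (mat X) := fun X =>
    poissonSum_nonneg (by simp) (mat_transpose_mul X) (mat_det X) hs hs1
  have key := integral_loop_equation ν hs hs1 m
  have hle : ∀ X : SOodd N,
      (N ^ 2 - poissonSum N s (mat X) ^ 2 - 2 * s / (1 - s ^ 2) * poissonSum N s (mat X))
          * poissonSum N s (mat X) ^ m
        + loopCorrection s (mat X) * (m * poissonSum N s (mat X) ^ (m - 1))
      ≤ (N ^ 2 + 4 * m * ((1 - s)⁻¹) ^ 2) * poissonSum N s (mat X) ^ m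
        - 2 * s / (1 - s ^ 2) * poissonSum N s (mat X) ^ (m + 1) := by
    intro X
    have hT := loopCorrection_le (N := N) (by simp) (mat_transpose_mul X) (mat_det X) hs hs1
    have hP := hP0 X
    set P := poissonSum N s (mat X)
    have h1 : loopCorrection s (mat X) * (m * P ^ (m - 1)) ≤ 4 * m * ((1 - s)⁻¹) ^ 2 * P ^ m := by
      rcases m with _ | k
      · simp
      · have := mul_le_mul_of_nonneg_right hT
          (by positivity : (0 : ℝ) ≤ ((k + 1 : ℕ) : ℝ) * P ^ (k + 1 - 1))
        refine this.trans (le_of_eq ?_)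
        rw [Nat.add_sub_cancel, pow_succ]
        ring
    have h2 : 0 ≤ P ^ 2 * P ^ m := by positivity
    rw [pow_succ P m]
    linarith
  have hmono := integral_mono (hfi _ (by fun_prop)) (hfi _ (by fun_prop)) hle
  rw [key, integral_sub (hfi _ (by fun_prop)) (hfi _ (by fun_prop)), integral_const_mul,
    integral_const_mul] at hmono
  linarith

lemma exp_neg_bounds {x : ℝ} (hx : 0 < x) (hx1 : x ≤ 1 / 2) :
    1 / 2 ≤ exp (-x) ∧ exp (-x) < 1 ∧ 1 - x ≤ exp (-x) ∧ (1 - exp (-x)) * (1 + x) ≥ x := by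
  have h1 := Real.add_one_le_exp (-x)
  have h2 : exp (-x) * (1 + x) ≤ 1 := by
    have h3 := Real.add_one_le_exp x
    have h4 : exp (-x) * exp x = 1 := by rw [← Real.exp_add]; simp
    nlinarith [Real.exp_pos (-x)]
  refine ⟨by linarith, by simpa using hx, by linarith, by linarith⟩

/-- All moments of `x * poissonSum` are of order `(x N)²`. -/
lemma exists_moment_bound (m : ℕ) : ∃ D : ℝ, 0 ≤ D ∧ ∀ (N : ℕ) (ν : Measure (SOodd N))
    [IsProbabilityMeasure ν] [ν.IsMulLeftInvariant] (x : ℝ), 0 < x → x ≤ 1 / 2 → x * N ≤ 1 →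
    x ^ (m + 1) * ∫ X, poissonSum N (exp (-x)) (mat X) ^ (m + 1) ∂ν ≤ D * (x * N) ^ 2 := by
  have step : ∀ (m N : ℕ) (ν : Measure (SOodd N)) [IsProbabilityMeasure ν]
      [ν.IsMulLeftInvariant] (x : ℝ), 0 < x → x ≤ 1 / 2 →
      x ^ (m + 1) * ∫ X, poissonSum N (exp (-x)) (mat X) ^ (m + 1) ∂ν
        ≤ (2 * (x * N) ^ 2 + 32 * m)
          * (x ^ m * ∫ X, poissonSum N (exp (-x)) (mat X) ^ m ∂ν) := by
    intro m N ν _ _ x hx hx1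
    obtain ⟨hs2, hs1, hsx, hsx'⟩ := exp_neg_bounds hx hx1
    have h := integral_poissonSum_pow_succ_le ν (Real.exp_pos (-x)).le hs1 m
    have hP0 : ∀ k, 0 ≤ ∫ X : SOodd N, poissonSum N (exp (-x)) (mat X) ^ k ∂ν := fun k =>
      integral_nonneg fun X => pow_nonneg (poissonSum_nonneg (by simp) (mat_transpose_mul X)
        (mat_det X) (Real.exp_pos (-x)).le hs1) k
    have hI := hP0 (m + 1)
    have hJ := hP0 m
    set s := exp (-x)
    set I := ∫ X : SOodd N, poissonSum N s (mat X) ^ (m + 1) ∂ν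
    set J := ∫ X : SOodd N, poissonSum N s (mat X) ^ m ∂ν
    have hs3 : 0 < 1 - s := by linarith
    have hc : 1 / (2 * x) ≤ 2 * s / (1 - s ^ 2) := by
      rw [div_le_div_iff₀ (by positivity) (by nlinarith)]
      nlinarith
    have hd : (1 - s)⁻¹ ≤ 2 / x := by
      rw [inv_eq_one_div, div_le_div_iff₀ hs3 hx]
      nlinarith
    have hd2 : ((1 - s)⁻¹) ^ 2 ≤ (2 / x) ^ 2 := pow_le_pow_left₀ (by positivity) hd 2
    have h1 : 1 / (2 * x) * I ≤ (N ^ 2 + 4 * m * (2 / x) ^ 2) * J :=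
      (mul_le_mul_of_nonneg_right hc hI).trans (h.trans (by gcongr))
    have h2 := mul_le_mul_of_nonneg_left h1 (by positivity : 0 ≤ 2 * x ^ 2 * x ^ m)
    calc x ^ (m + 1) * I = 2 * x ^ 2 * x ^ m * (1 / (2 * x) * I) := by
          field_simp
          ring
      _ ≤ _ := h2
      _ = _ := by field_simp; ring
  induction m with
  | zero =>
    refine ⟨2, by norm_num, fun N ν _ _ x hx hx1 _ => ?_⟩
    have h := step 0 N ν x hx hx1
    simpa using h
  | succ k ih =>
    obtain ⟨D, hD0, hD⟩ := ih
    refine ⟨(2 + 32 * (k + 1 : ℕ)) * D, by positivity, fun N ν _ _ x hx hx1 hxN => ?_⟩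
    have h1 := step (k + 1) N ν x hx hx1
    have h2 := hD N ν x hx hx1 hxN
    have h3 : (x * N) ^ 2 ≤ 1 := pow_le_one₀ (by positivity) hxN
    calc _ ≤ _ := h1
      _ ≤ (2 * (x * N) ^ 2 + 32 * (k + 1 : ℕ)) * (D * (x * N) ^ 2) := by gcongr
      _ ≤ (2 * 1 + 32 * (k + 1 : ℕ)) * (D * (x * N) ^ 2) := by gcongr
      _ = _ := by ring

lemma exists_one_add_pow_moment_bound (m : ℕ) : ∃ D : ℝ, 0 ≤ D ∧ ∀ (N : ℕ)
    (ν : Measure (SOodd N))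
    [IsProbabilityMeasure ν] [ν.IsMulLeftInvariant] (x : ℝ), 0 < x → x ≤ 1 / 2 → x * N ≤ 1 →
    ∫ X, (1 + 4 * x * poissonSum N (exp (-x)) (mat X)) ^ m ∂ν ≤ 1 + D * (x * N) ^ 2 := by
  choose D hD0 hD using exists_moment_bound
  refine ⟨∑ k ∈ Finset.range m, 4 ^ (k + 1) * m.choose (k + 1) * D k,
    Finset.sum_nonneg fun k _ => mul_nonneg (by positivity) (hD0 k), fun N ν _ _ x hx hx1 hxN => ?_⟩
  have hPc := continuous_poissonSum_mat (N := N) (Real.exp_pos (-x)).le (exp_neg_bounds hx hx1).2.1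
  have h : ∀ X : SOodd N, (1 + 4 * x * poissonSum N (exp (-x)) (mat X)) ^ m
      = 1 + ∑ k ∈ Finset.range m, 4 ^ (k + 1) * m.choose (k + 1)
        * (x ^ (k + 1) * poissonSum N (exp (-x)) (mat X) ^ (k + 1)) := by
    intro X
    rw [add_comm, add_pow, Finset.sum_range_succ', add_comm]
    simp only [one_pow, mul_one, pow_zero, Nat.choose_zero_right, Nat.cast_one, mul_pow]
    congr 1
    exact Finset.sum_congr rfl fun k _ => by ring
  have hfi : ∀ f : SOodd N → ℝ, Continuous f → Integrable f ν := fun f hf =>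
    hf.integrable_of_hasCompactSupport (HasCompactSupport.of_compactSpace f)
  simp_rw [h]
  rw [integral_add (integrable_const _) (hfi _ (by fun_prop)),
    integral_finsetSum _ fun k _ => hfi _ (by fun_prop)]
  simp only [integral_const_mul, integral_const, probReal_univ, one_smul]
  rw [Finset.sum_mul]
  refine add_le_add le_rfl (Finset.sum_le_sum fun k _ => ?_)
  rw [mul_assoc _ (D k)]
  exact mul_le_mul_of_nonneg_left (hD k N ν x hx hx1 hxN) (by positivity)

lemma neg_logDeriv_charPoly (X : SOodd N) {s : ℝ} (hs : 0 < s) (hs1 : s < 1) :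
    -(logDeriv (charPoly X) s) = s⁻¹ * (poissonSum N s (mat X) + (1 - s)⁻¹ - 1 - N) := by
  have hX : (mat X)ᵀᵀ * (mat X)ᵀ = 1 := by
    simpa using mul_eq_one_comm.mp (mat_transpose_mul X)
  have hd : HasDerivAt (charPoly X)
      (-(charPoly X s * ((mat X)ᵀ * resolv s (mat X)ᵀ).trace)) s :=
    hasDerivAt_det_one_sub_smul hX hs.le hs1
  have h0 : charPoly X s ≠ 0 := (isUnit_det_one_sub_smul hX hs.le hs1).ne_zero
  have ht := congrArg trace (smul_mul_resolv hX hs.le hs1)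
  rw [trace_smul, trace_sub, trace_one, ← resolv_transpose, trace_transpose, smul_eq_mul,
    resolv_transpose] at ht
  rw [logDeriv_apply, hd.deriv, neg_div, neg_neg, mul_div_cancel_left₀ _ h0, eq_inv_mul_iff_mul_eq₀
    hs.ne', ht, poissonSum]
  simp
  ring

/-- Second-order control of `u ↦ u ^ K` near `u = 1`. -/
lemma abs_rpow_sub_one_sub_le {K u : ℝ} (hK : 0 < K) (hu : 1 / 2 ≤ u)
    (hKu : 2 * K * |u - 1| ≤ 1) :
    |u ^ K - 1 - K * (u - 1)| ≤ (4 * K ^ 2 + 2 * K) * (u - 1) ^ 2 := by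
  have hu0 : 0 < u := by linarith
  have h1 := Real.log_le_sub_one_of_pos hu0
  have h2 := Real.one_sub_inv_le_log_of_pos hu0
  have h3 : 1 - u⁻¹ = (u - 1) / u := by field_simp
  have h4 : (u - 1) - 2 * (u - 1) ^ 2 ≤ log u := by
    refine le_trans ?_ h2
    rw [h3, le_div_iff₀ hu0]
    nlinarith [mul_nonneg (sq_nonneg (u - 1)) (by linarith : (0 : ℝ) ≤ 2 * u - 1)]
  have h5 : |log u| ≤ 2 * |u - 1| := by
    rw [abs_le]
    constructor
    · refine le_trans ?_ h2
      rw [h3, le_div_iff₀ hu0]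
      rcases abs_cases (u - 1) with ⟨h, _⟩ | ⟨h, _⟩ <;> rw [h] <;> nlinarith
    · exact h1.trans ((le_abs_self _).trans (by linarith [abs_nonneg (u - 1)]))
  have h6 : |K * log u| ≤ 2 * K * |u - 1| := by
    rw [abs_mul, abs_of_pos hK]
    nlinarith
  have h7 := Real.abs_exp_sub_one_sub_id_le (h6.trans hKu)
  have h8 : (K * log u) ^ 2 ≤ 4 * K ^ 2 * (u - 1) ^ 2 := by
    rw [← sq_abs (K * log u), ← sq_abs (u - 1)]
    have := pow_le_pow_left₀ (abs_nonneg _) h6 2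
    linarith
  have h9 : |K * log u - K * (u - 1)| ≤ 2 * K * (u - 1) ^ 2 := by
    rw [← mul_sub, abs_mul, abs_of_pos hK, abs_sub_comm, abs_of_nonneg (by linarith)]
    nlinarith
  rw [Real.rpow_def_of_pos hu0, mul_comm (log u) K]
  have : exp (K * log u) - 1 - K * (u - 1)
      = (exp (K * log u) - 1 - K * log u) + (K * log u - K * (u - 1)) := by ring
  rw [this]
  refine (abs_add_le _ _).trans ?_
  linarith


/-- Bounds for `x` times the matrix-independent part of the negated logarithmic derivative at
`exp (-x)`. -/
lemma deterministic_part_bounds {x a n : ℝ} (hx : 0 < x) (hxa : x ≤ a) (ha : a ≤ 1 / 8)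
    (hn : x * n = a) :
    1 / 2 ≤ x * ((exp (-x))⁻¹ * ((1 - exp (-x))⁻¹ - 1 - n)) ∧
    x * ((exp (-x))⁻¹ * ((1 - exp (-x))⁻¹ - 1 - n)) ≤ 1 ∧
    |x * ((exp (-x))⁻¹ * ((1 - exp (-x))⁻¹ - 1 - n)) - 1| ≤ 3 * a ∧
    |x * ((exp (-x))⁻¹ * ((1 - exp (-x))⁻¹ - 1 - n)) - 1 + a| ≤ x := by
  obtain ⟨hs2, hs1, hsx, hsx'⟩ := exp_neg_bounds hx (by linarith)
  set s := exp (-x)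
  have hs0 : 0 < s := by linarith
  have hs3 : 0 < 1 - s := by linarith
  have hu : x * (s⁻¹ * ((1 - s)⁻¹ - 1 - n)) = x / (1 - s) - a * s⁻¹ := by
    rw [← hn]
    field_simp
    ring
  have h1 : 1 ≤ x / (1 - s) := by rw [le_div_iff₀ hs3]; linarith
  have h2 : x / (1 - s) ≤ 1 + x := by rw [div_le_iff₀ hs3]; linarith
  have h3 : 1 ≤ s⁻¹ := (one_le_inv₀ hs0).mpr hs1.le
  have h4 : s⁻¹ ≤ 1 + 2 * x := by
    rw [inv_le_iff_one_le_mul₀ hs0]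
    nlinarith
  have h5 : a ≤ a * s⁻¹ := by nlinarith
  have h6 : a * s⁻¹ ≤ a + x / 4 := by nlinarith
  rw [hu]
  refine ⟨by linarith, by linarith, ?_, ?_⟩ <;> rw [abs_le] <;> constructor <;> linarith

/-- The moment of order `K` at `s = exp (-x)` differs from its deterministic part by
`O((x N)²)`. -/
lemma exists_integral_rpow_bound {K : ℝ} (hK : 0 < K) : ∃ D : ℝ, 0 ≤ D ∧ ∀ (N : ℕ)
    (ν : Measure (SOodd N)) [IsProbabilityMeasure ν] [ν.IsMulLeftInvariant] (x u : ℝ), 0 < x →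
    x ≤ 1 / 2 → x * N ≤ 1 → 1 / 2 ≤ u → u ≤ 1 →
    u = x * ((exp (-x))⁻¹ * ((1 - exp (-x))⁻¹ - 1 - N)) →
    (∀ X : SOodd N, 0 < -(logDeriv (charPoly X) (exp (-x)))) ∧
    |x ^ K * ∫ X, (-(logDeriv (charPoly X) (exp (-x)))) ^ K ∂ν - u ^ K| ≤ D * (x * N) ^ 2 := by
  obtain ⟨D, hD0, hD⟩ := exists_one_add_pow_moment_bound ⌈K⌉₊
  refine ⟨D, hD0, fun N ν _ _ x u hx hx1 hxN hu hu1 hu_eq => ?_⟩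
  have hE := hD N ν x hx hx1 hxN
  obtain ⟨hs2, hs1, -, -⟩ := exp_neg_bounds hx hx1
  have hs0 := Real.exp_pos (-x)
  have hPc := continuous_poissonSum_mat (N := N) hs0.le hs1
  have hP0 : ∀ X : SOodd N, 0 ≤ poissonSum N (exp (-x)) (mat X) := fun X =>
    poissonSum_nonneg (by simp) (mat_transpose_mul X) (mat_det X) hs0.le hs1
  have hZ := fun X : SOodd N => neg_logDeriv_charPoly X hs0 hs1
  set s := exp (-x)
  set P : SOodd N → ℝ := fun X => poissonSum N s (mat X)
  have hu0 : 0 < u := by linarith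
  have hxZ : ∀ X : SOodd N, x * -(logDeriv (charPoly X) s) = u + x * (s⁻¹ * P X) := by
    intro X
    rw [hZ, hu_eq]
    ring
  have hs_inv : s⁻¹ ≤ 2 := by
    rw [inv_le_iff_one_le_mul₀ hs0]
    linarith
  have hs_inv0 : 0 < s⁻¹ := inv_pos.mpr hs0
  have hw0 : ∀ X, 0 ≤ x * (s⁻¹ * P X) := fun X =>
    mul_nonneg hx.le (mul_nonneg hs_inv0.le (hP0 X))
  have hpos : ∀ X : SOodd N, 0 < -(logDeriv (charPoly X) s) := fun X =>
    pos_of_mul_pos_right ((hxZ X).symm ▸ add_pos_of_pos_of_nonneg hu0 (hw0 X)) hx.le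
  refine ⟨hpos, ?_⟩
  have hfi : ∀ f : SOodd N → ℝ, Continuous f → Integrable f ν := fun f hf =>
    hf.integrable_of_hasCompactSupport (HasCompactSupport.of_compactSpace f)
  have hI : x ^ K * ∫ X, (-(logDeriv (charPoly X) s)) ^ K ∂ν
      = ∫ X, (u + x * (s⁻¹ * P X)) ^ K ∂ν := by
    rw [← integral_const_mul]
    refine integral_congr_ae (Eventually.of_forall fun X => ?_)
    dsimp only
    rw [← hxZ, Real.mul_rpow hx.le (hpos X).le]
  have hfc : Continuous fun X : SOodd N => (u + x * (s⁻¹ * P X)) ^ K :=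
    Continuous.rpow_const (by fun_prop) fun _ => Or.inr hK.le
  have huK : u ^ K ≤ 1 := Real.rpow_le_one hu0.le hu1 hK.le
  have huK0 : 0 ≤ u ^ K := Real.rpow_nonneg hu0.le K
  have hlow : u ^ K ≤ ∫ X, (u + x * (s⁻¹ * P X)) ^ K ∂ν := by
    have := integral_mono (integrable_const (μ := ν) (u ^ K)) (hfi _ hfc) fun X =>
      Real.rpow_le_rpow hu0.le (le_add_of_nonneg_right (hw0 X)) hK.le
    simpa using this
  have hpt : ∀ X : SOodd N,
      (u + x * (s⁻¹ * P X)) ^ K ≤ u ^ K * (1 + 4 * x * P X) ^ ⌈K⌉₊ := by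
    intro X
    have hPX : 0 ≤ P X := hP0 X
    have hxP : 0 ≤ x * P X := mul_nonneg hx.le hPX
    have h1 : u + x * (s⁻¹ * P X) ≤ u * (1 + 4 * x * P X) := by
      nlinarith [mul_le_mul_of_nonneg_right hs_inv hxP,
        mul_le_mul_of_nonneg_right hu hxP]
    have h2 : 1 ≤ 1 + 4 * x * P X := by nlinarith
    calc (u + x * (s⁻¹ * P X)) ^ K
        ≤ (u * (1 + 4 * x * P X)) ^ K :=
          Real.rpow_le_rpow (add_nonneg hu0.le (hw0 X)) h1 hK.le
      _ = u ^ K * (1 + 4 * x * P X) ^ K := Real.mul_rpow hu0.le (by linarith)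
      _ ≤ u ^ K * (1 + 4 * x * P X) ^ (⌈K⌉₊ : ℝ) :=
          mul_le_mul_of_nonneg_left (Real.rpow_le_rpow_of_exponent_le h2 (Nat.le_ceil K)) huK0
      _ = _ := by rw [Real.rpow_natCast]
  have hup : ∫ X, (u + x * (s⁻¹ * P X)) ^ K ∂ν ≤ u ^ K * (1 + D * (x * N) ^ 2) := by
    refine (integral_mono (hfi _ hfc) (hfi _ (by fun_prop)) hpt).trans ?_
    rw [integral_const_mul]
    exact mul_le_mul_of_nonneg_left hE huK0
  rw [hI, abs_of_nonneg (by linarith)]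
  have hDx : 0 ≤ D * (x * N) ^ 2 := by positivity
  nlinarith

end Moments

/-- Non-integer moments of the logarithmic derivative of characteristic polynomials over
`SO(2N+1)`: leading asymptotics `1 - K a_N` with error `O(a_N/N) + O(a_N²)`. -/
theorem nonInteger_moments_logDeriv_SOodd
    (K : ℝ) (hK : 0 < K)
    (a : ℕ → ℝ) (hapos : ∀ N : ℕ, 1 ≤ N → 0 < a N)
    (halim : Tendsto a atTop (nhds 0))
    (μ : (N : ℕ) → Measure (SOodd N))
    (hμHaar : ∀ N : ℕ, (μ N).IsHaarMeasure)
    (hμProb : ∀ N : ℕ, IsProbabilityMeasure (μ N)) :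
    ∃ C : ℝ, 0 < C ∧ ∃ N₀ : ℕ, ∀ N : ℕ, N₀ ≤ N →
      (∀ X : SOodd N, 0 < -(logDeriv (charPoly X) (Real.exp (-(a N) / N)))) ∧
      |(a N / N) ^ K *
            (∫ X, (-(logDeriv (charPoly X) (Real.exp (-(a N) / N)))) ^ K ∂(μ N)) -
          (1 - K * a N)| ≤
        C * (a N / N + a N ^ 2) := by
  obtain ⟨D, hD0, hD⟩ := exists_integral_rpow_bound hK
  refine ⟨D + K + 9 * (4 * K ^ 2 + 2 * K), by positivity, ?_⟩
  have hev : ∀ᶠ N in atTop, a N < min (1 / 8) (1 / (6 * K + 1)) :=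
    halim.eventually_lt_const (by positivity)
  obtain ⟨N₁, hN₁⟩ := eventually_atTop.mp hev
  refine ⟨max N₁ 1, fun N hN => ?_⟩
  have hN1 : 1 ≤ N := (le_max_right _ _).trans hN
  obtain ⟨ha8, haK⟩ := lt_min_iff.mp (hN₁ N ((le_max_left _ _).trans hN))
  have ha := hapos N hN1
  have := hμHaar N
  have := hμProb N
  have hNR : (1 : ℝ) ≤ N := by exact_mod_cast hN1
  have hN0 : (0 : ℝ) < N := by linarith
  rw [neg_div]
  have hx : 0 < a N / N := by positivity
  have hxa : a N / N ≤ a N := div_le_self ha.le hNR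
  have hxN : a N / N * N = a N := div_mul_cancel₀ _ hN0.ne'
  obtain ⟨hu2, hu1, hud, hua⟩ := deterministic_part_bounds hx hxa ha8.le hxN
  have hmain := hD N (μ N) (a N / N) _ hx (by linarith) (by linarith) hu2 hu1 rfl
  rw [hxN] at hmain
  set x := a N / N
  set u := x * ((exp (-x))⁻¹ * ((1 - exp (-x))⁻¹ - 1 - N))
  refine ⟨hmain.1, ?_⟩
  have hKa : 6 * K * a N ≤ 1 := by
    rw [lt_div_iff₀ (by positivity)] at haK
    nlinarith
  have hrpow := abs_rpow_sub_one_sub_le hK hu2 (by nlinarith)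
  have hsq : (u - 1) ^ 2 ≤ 9 * a N ^ 2 := by
    rw [← sq_abs]
    nlinarith [abs_nonneg (u - 1)]
  have hlin : |K * (u - 1 + a N)| ≤ K * x := by
    rw [abs_mul, abs_of_pos hK]
    exact mul_le_mul_of_nonneg_left hua hK.le
  have hsq' : (4 * K ^ 2 + 2 * K) * (u - 1) ^ 2 ≤ (4 * K ^ 2 + 2 * K) * (9 * a N ^ 2) :=
    mul_le_mul_of_nonneg_left hsq (by positivity)
  have hbound : ∀ I : ℝ, |I - u ^ K| ≤ D * a N ^ 2 → |I - (1 - K * a N)| ≤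
      D * a N ^ 2 + (4 * K ^ 2 + 2 * K) * (9 * a N ^ 2) + K * x := by
    intro I hI
    have : I - (1 - K * a N)
        = (I - u ^ K) + (u ^ K - 1 - K * (u - 1)) + K * (u - 1 + a N) := by ring
    rw [this]
    exact (abs_add_three _ _ _).trans (by linarith)
  refine (hbound _ hmain.2).trans ?_
  have h1 : 0 ≤ (D + 9 * (4 * K ^ 2 + 2 * K)) * x := by positivity
  have h2 : 0 ≤ K * a N ^ 2 := by positivity
  linarith
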